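/- arXiv:2207.06212 — 2 statements merged into one kernel-verified Lean document; each statement's English description precedes it below -/
import Mathlib

section
/- For every positive integer n and every real number x, B̂_n(x) = ∑_{σ ∈ S_n^0} (1+x)^{dda(σ)} · 2^{val(σ)} · (1+x^2)^{pk(σ)}, where the sum is over all permutations σ of {1,...,n} with the boundary convention σ(0) = 0, σ(n+1) = n+1. -/
open Finset

/-- The word of a permutation of `{1,...,n}` with boundary convention `σ(0) = σ(n+1) = n+1`. -/
def extA (n : ℕ) (σ : Equiv.Perm (Fin n)) : ℕ → ℕ := fun i =>
  if h : 1 ≤ i ∧ i ≤ n then (σ ⟨i - 1, by omega⟩ : ℕ) + 1 else n + 1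

/-- The word of a permutation of `{1,...,n}` with boundary convention `σ(0) = 0`, `σ(n+1) = n+1`. -/
def ext0 (n : ℕ) (σ : Equiv.Perm (Fin n)) : ℕ → ℕ := fun i =>
  if h : 1 ≤ i ∧ i ≤ n then (σ ⟨i - 1, by omega⟩ : ℕ) + 1
  else if i = 0 then 0 else n + 1

/-- Number of double ascents (indices `i ∈ {1,...,n}` with `w(i-1) < w(i) < w(i+1)`). -/
def daCount (n : ℕ) (w : ℕ → ℕ) : ℕ :=
  ((Icc 1 n).filter fun i => w (i - 1) < w i ∧ w i < w (i + 1)).card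

/-- Number of double descents (indices `i ∈ {1,...,n}` with `w(i-1) > w(i) > w(i+1)`). -/
def ddCount (n : ℕ) (w : ℕ → ℕ) : ℕ :=
  ((Icc 1 n).filter fun i => w i < w (i - 1) ∧ w (i + 1) < w i).card

/-- Number of valleys (indices `i ∈ {1,...,n}` with `w(i-1) > w(i) < w(i+1)`). -/
def valCount (n : ℕ) (w : ℕ → ℕ) : ℕ :=
  ((Icc 1 n).filter fun i => w i < w (i - 1) ∧ w i < w (i + 1)).card

/-- Number of peaks (indices `i ∈ {1,...,n}` with `w(i-1) < w(i) > w(i+1)`). -/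
def pkCount (n : ℕ) (w : ℕ → ℕ) : ℕ :=
  ((Icc 1 n).filter fun i => w (i - 1) < w i ∧ w (i + 1) < w i).card

/-- `dda = da + dd`. -/
def ddaCount (n : ℕ) (w : ℕ → ℕ) : ℕ := daCount n w + ddCount n w

/-- Number of alternating descents of a permutation of `{1,...,n}`:
indices `i ∈ {1,...,n-1}` with `σ(i) > σ(i+1)` and `i` odd, or `σ(i) < σ(i+1)` and `i` even. -/
def altDesA (n : ℕ) (σ : Equiv.Perm (Fin n)) : ℕ :=
  ((Ico 1 n).filter fun i =>
    (Odd i ∧ extA n σ (i + 1) < extA n σ i) ∨ (Even i ∧ extA n σ i < extA n σ (i + 1))).card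

/-- The alternating Eulerian polynomial `Â_n(x)`. -/
noncomputable def hatA (n : ℕ) (x : ℝ) : ℝ := ∑ σ : Equiv.Perm (Fin n), x ^ altDesA n σ

/-- The signed word of a type B permutation encoded as a pair `(σ, ε)` of a permutation of
`{1,...,n}` and a sign vector; position `0` (and positions `> n`) carry the value `0`. -/
def wordB (n : ℕ) (σ : Equiv.Perm (Fin n)) (ε : Fin n → Bool) : ℕ → ℤ := fun i =>
  if h : 1 ≤ i ∧ i ≤ n then
    (if ε ⟨i - 1, by omega⟩ then ((σ ⟨i - 1, by omega⟩ : ℕ) + 1 : ℤ)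
     else -((σ ⟨i - 1, by omega⟩ : ℕ) + 1 : ℤ))
  else 0

/-- `i` is an alternating descent position of the word `w`:
either `i` is even and `w(i) < w(i+1)`, or `i` is odd and `w(i) > w(i+1)`. -/
def isAltDesZ (w : ℕ → ℤ) (i : ℕ) : Prop :=
  (Even i ∧ w i < w (i + 1)) ∨ (Odd i ∧ w (i + 1) < w i)

instance (w : ℕ → ℤ) : DecidablePred (isAltDesZ w) := fun i => by
  unfold isAltDesZ; infer_instance

/-- `d̂_B`: number of type B alternating descent positions `i ∈ {0,1,...,n-1}`. -/
def altDesB (n : ℕ) (σ : Equiv.Perm (Fin n)) (ε : Fin n → Bool) : ℕ :=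
  ((range n).filter (isAltDesZ (wordB n σ ε))).card

/-- The type B alternating Eulerian polynomial `B̂_n(x)`. -/
noncomputable def hatB (n : ℕ) (x : ℝ) : ℝ :=
  ∑ p : Equiv.Perm (Fin n) × (Fin n → Bool), x ^ altDesB n p.1 p.2

/-- `d̂`: number of alternating descent positions `i ∈ {1,...,n-1}` of a signed word
(position `0` excluded). -/
def altDesWord (n : ℕ) (w : ℕ → ℤ) : ℕ := ((Ico 1 n).filter (isAltDesZ w)).card

/-- Derivative polynomials of the tangent function: `P₀ = X`, `P_{n+1} = (1+X²)·Pₙ'`. -/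
noncomputable def tanP : ℕ → Polynomial ℝ
  | 0 => Polynomial.X
  | n + 1 => (1 + Polynomial.X ^ 2) * Polynomial.derivative (tanP n)

/-- Derivative polynomials of the secant function: `Q₀ = 1`, `Q_{n+1} = X·Qₙ + (1+X²)·Qₙ'`. -/
noncomputable def secQ : ℕ → Polynomial ℝ
  | 0 => 1
  | n + 1 => Polynomial.X * secQ n + (1 + Polynomial.X ^ 2) * Polynomial.derivative (secQ n)

/-- The word of `(σ, ε)` is down-up alternating: `π(1) > π(2) < π(3) > π(4) ⋯`. -/
def isDownUpB (m : ℕ) (σ : Equiv.Perm (Fin m)) (ε : Fin m → Bool) : Prop :=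
  ∀ i ∈ Ico 1 m,
    (Odd i → wordB m σ ε (i + 1) < wordB m σ ε i) ∧
    (Even i → wordB m σ ε i < wordB m σ ε (i + 1))

instance (m : ℕ) (σ : Equiv.Perm (Fin m)) (ε : Fin m → Bool) : Decidable (isDownUpB m σ ε) := by
  unfold isDownUpB; infer_instance

/-- `DU_m^{(B)}`: the number of down-up alternating type B permutations of length `m`. -/
def duBCount (m : ℕ) : ℕ :=
  (Finset.univ.filter fun p : Equiv.Perm (Fin m) × (Fin m → Bool) =>
    isDownUpB m p.1 p.2).card

/-- `S_m`: the number of snakes of length `m` (down-up alternating type B permutations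
whose first entry is positive). -/
def snakeCount (m : ℕ) : ℕ :=
  (Finset.univ.filter fun p : Equiv.Perm (Fin m) × (Fin m → Bool) =>
    0 < wordB m p.1 p.2 1 ∧ isDownUpB m p.1 p.2).card

/-- `B̂_n^-(x)`: sum over type B permutations with negative first entry. -/
noncomputable def hatBminus (n : ℕ) (x : ℝ) : ℝ :=
  ∑ p ∈ Finset.univ.filter
      (fun p : Equiv.Perm (Fin n) × (Fin n → Bool) => wordB n p.1 p.2 1 < 0),
    x ^ altDesB n p.1 p.2

/-- `B̂_n^+(x)`: sum over type B permutations with positive first entry. -/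
noncomputable def hatBplus (n : ℕ) (x : ℝ) : ℝ :=
  ∑ p ∈ Finset.univ.filter
      (fun p : Equiv.Perm (Fin n) × (Fin n → Bool) => 0 < wordB n p.1 p.2 1),
    x ^ altDesB n p.1 p.2

/-- The factor contributed by an adjacent comparison decided by an entry at position `i`
whose sign is positive exactly when `p` holds. -/
noncomputable def signWeight (x : ℝ) (i : ℕ) (p : Prop) : ℝ :=
  open Classical in if (Odd i ↔ p) then x else 1

lemma signWeight_add (x : ℝ) (i : ℕ) :
    signWeight x i True + signWeight x i False = 1 + x := by
  by_cases h : Odd i <;> simp [signWeight, h, add_comm]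

lemma signWeight_mul_self_add (x : ℝ) (i : ℕ) :
    signWeight x i True * signWeight x i True +
      signWeight x i False * signWeight x i False = 1 + x ^ 2 := by
  by_cases h : Odd i <;> simp [signWeight, h, add_comm, sq]

/-- The factor contributed by the entry at position `i` of a word with absolute values `w`. -/
noncomputable def entryWeight (x : ℝ) (w : ℕ → ℕ) (i : ℕ) (p : Prop) : ℝ :=
  (if w (i - 1) < w i then signWeight x i p else 1) *
    (if w (i + 1) < w i then signWeight x i p else 1)

lemma ite_isAltDesZ (x : ℝ) (w : ℕ → ℕ) (W : ℕ → ℤ) (j : ℕ)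
    (h₀ : |W j| = w j) (h₁ : |W (j + 1)| = w (j + 1)) (hne : w j ≠ w (j + 1)) :
    (if isAltDesZ W j then x else 1) =
      (if w j < w (j + 1) then signWeight x (j + 1) (0 < W (j + 1)) else 1) *
        (if w (j + 1) < w j then signWeight x j (0 < W j) else 1) := by
  have hlt₀ := abs_eq (Int.natCast_nonneg (w j)) |>.mp h₀
  have hlt₁ := abs_eq (Int.natCast_nonneg (w (j + 1))) |>.mp h₁
  rcases lt_or_gt_of_ne hne with h | h
  · have key : isAltDesZ W j ↔ (Odd (j + 1) ↔ 0 < W (j + 1)) := by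
      rw [Nat.odd_add_one, isAltDesZ, ← Nat.not_odd_iff_even]
      by_cases ho : Odd j <;> simp only [ho, not_true, not_false_iff, true_and, false_and,
        or_false, false_or, true_iff, false_iff] <;> omega
    simp [h, h.not_gt, signWeight, key]
  · have key : isAltDesZ W j ↔ (Odd j ↔ 0 < W j) := by
      rw [isAltDesZ, ← Nat.not_odd_iff_even]
      by_cases ho : Odd j <;> simp only [ho, not_true, not_false_iff, true_and, false_and,
        or_false, false_or, true_iff, false_iff] <;> omega
    simp [h, h.not_gt, signWeight, key]

lemma pow_card_isAltDesZ (x : ℝ) (n : ℕ) (w : ℕ → ℕ) (W : ℕ → ℤ)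
    (habs : ∀ i ≤ n, |W i| = w i) (hne : ∀ i < n, w i ≠ w (i + 1))
    (hzero : w 0 = 0) (hlast : w n < w (n + 1)) :
    x ^ ((range n).filter (isAltDesZ W)).card =
      ∏ j ∈ range n, entryWeight x w (j + 1) (0 < W (j + 1)) := by
  have hshift : ∏ j ∈ range n, (if w (j + 1) < w j then signWeight x j (0 < W j) else 1) =
      ∏ j ∈ range n, (if w (j + 1 + 1) < w (j + 1) then
        signWeight x (j + 1) (0 < W (j + 1)) else 1) := by
    have h := prod_range_succ' (fun j => if w (j + 1) < w j then
      signWeight x j (0 < W j) else 1) n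
    rw [prod_range_succ] at h
    simpa [hzero, hlast.not_gt] using h
  have hsplit : ∀ j ∈ range n, (if isAltDesZ W j then x else 1) = _ := fun j hj =>
    have hj := mem_range.mp hj
    ite_isAltDesZ x w W j (habs j hj.le) (habs (j + 1) hj) (hne j hj)
  rw [← prod_const, prod_filter, prod_congr rfl hsplit, prod_mul_distrib, hshift,
    ← prod_mul_distrib]
  rfl

lemma pow_card_filter_Icc (a : ℝ) (n : ℕ) (p : ℕ → Prop) [DecidablePred p] :
    a ^ ((Icc 1 n).filter p).card = ∏ j ∈ range n, if p (j + 1) then a else 1 := by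
  rw [← prod_const, prod_filter, ← Ico_add_one_right_eq_Icc, prod_Ico_eq_prod_range]
  simp [add_comm]

lemma entryWeight_add (x : ℝ) (w : ℕ → ℕ) (i : ℕ)
    (h₀ : w (i - 1) ≠ w i) (h₁ : w i ≠ w (i + 1)) :
    entryWeight x w i True + entryWeight x w i False =
      (if w (i - 1) < w i ∧ w i < w (i + 1) then 1 + x else 1) *
      (if w i < w (i - 1) ∧ w (i + 1) < w i then 1 + x else 1) *
      (if w i < w (i - 1) ∧ w i < w (i + 1) then 2 else 1) *
      (if w (i - 1) < w i ∧ w (i + 1) < w i then 1 + x ^ 2 else 1) := by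
  unfold entryWeight
  rcases lt_or_gt_of_ne h₀ with h | h <;> rcases lt_or_gt_of_ne h₁ with h' | h' <;>
    simp only [h, h', h.not_gt, h'.not_gt, if_true, if_false, and_true, and_false, mul_one,
      one_mul, signWeight_add, signWeight_mul_self_add]
  norm_num

lemma prod_entryWeight_add (x : ℝ) (n : ℕ) (w : ℕ → ℕ) (hne : ∀ i ≤ n, w i ≠ w (i + 1)) :
    ∏ j ∈ range n, (entryWeight x w (j + 1) True +
        entryWeight x w (j + 1) False) =
      (1 + x) ^ ddaCount n w * 2 ^ valCount n w * (1 + x ^ 2) ^ pkCount n w := by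
  simp only [ddaCount, daCount, ddCount, valCount, pkCount, pow_add, pow_card_filter_Icc,
    ← prod_mul_distrib]
  refine prod_congr rfl fun j hj => ?_
  have hj := mem_range.mp hj
  exact entryWeight_add x w (j + 1) (hne j hj.le) (hne (j + 1) hj)

lemma ext0_zero (n : ℕ) (σ : Equiv.Perm (Fin n)) : ext0 n σ 0 = 0 := by simp [ext0]

lemma ext0_succ {n : ℕ} (σ : Equiv.Perm (Fin n)) (k : Fin n) :
    ext0 n σ (k + 1) = σ k + 1 := by
  simp [ext0]

lemma ext0_last (n : ℕ) (σ : Equiv.Perm (Fin n)) : ext0 n σ (n + 1) = n + 1 := by simp [ext0]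

lemma ext0_ne_succ (n : ℕ) (σ : Equiv.Perm (Fin n)) (i : ℕ) (hi : i ≤ n) :
    ext0 n σ i ≠ ext0 n σ (i + 1) := by
  rcases hi.lt_or_eq with h | rfl
  · have h₁ := ext0_succ σ ⟨i, h⟩
    rcases i with _ | i
    · simp_all [ext0_zero]
    · have h₀ := ext0_succ σ ⟨i, by omega⟩
      simp only at h₀ h₁
      rw [h₀, h₁]
      intro heq
      have := σ.injective (Fin.ext (Nat.succ_injective heq))
      simp at this
  · rcases i with _ | i
    · simp [ext0]
    · have h₀ := ext0_succ σ ⟨i, by omega⟩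
      have := (σ ⟨i, by omega⟩).isLt
      simp only at h₀
      rw [h₀, ext0_last]
      omega

lemma ext0_lt_last (n : ℕ) (σ : Equiv.Perm (Fin n)) : ext0 n σ n < ext0 n σ (n + 1) := by
  refine lt_of_le_of_ne ?_ (ext0_ne_succ n σ n le_rfl)
  rw [ext0_last, ext0]
  split_ifs <;> omega

lemma abs_wordB (n : ℕ) (σ : Equiv.Perm (Fin n)) (ε : Fin n → Bool) (i : ℕ) (hi : i ≤ n) :
    |wordB n σ ε i| = ext0 n σ i := by
  unfold wordB ext0
  split_ifs <;> first | omega | (push_cast; rw [abs_eq (by omega)]; omega)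

lemma wordB_succ_pos {n : ℕ} (σ : Equiv.Perm (Fin n)) (ε : Fin n → Bool) (k : Fin n) :
    0 < wordB n σ ε (k + 1) ↔ ε k = true := by
  cases h : ε k <;> simp [wordB, h]

/-- For every positive integer `n` and real `x`,
`B̂_n(x) = ∑_{σ ∈ S_n⁰} (1+x)^{dda(σ)} · 2^{val(σ)} · (1+x²)^{pk(σ)}`,
with the boundary convention `σ(0) = 0`, `σ(n+1) = n+1`. -/
theorem stmt1 (n : ℕ) (hn : 0 < n) (x : ℝ) :
    hatB n x =
      ∑ σ : Equiv.Perm (Fin n),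
        (1 + x) ^ ddaCount n (ext0 n σ) * 2 ^ valCount n (ext0 n σ) *
          (1 + x ^ 2) ^ pkCount n (ext0 n σ) := by
  simp only [hatB, Fintype.sum_prod_type]
  refine sum_congr rfl fun σ _ => ?_
  rw [← prod_entryWeight_add x n _ (ext0_ne_succ n σ), ← Fin.prod_univ_eq_prod_range]
  have hsum : ∀ k : Fin n, entryWeight x (ext0 n σ) (k + 1) True +
      entryWeight x (ext0 n σ) (k + 1) False =
      ∑ b : Bool, entryWeight x (ext0 n σ) (k + 1) (b = true) := fun k =>
    by simp
  simp only [hsum]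
  rw [Fintype.prod_sum]
  refine sum_congr rfl fun ε _ => ?_
  rw [altDesB, pow_card_isAltDesZ x n (ext0 n σ) _ (abs_wordB n σ ε)
    (fun i hi => ext0_ne_succ n σ i hi.le) (ext0_zero n σ) (ext0_lt_last n σ),
    ← Fin.prod_univ_eq_prod_range
      (fun j => entryWeight x (ext0 n σ) (j + 1) (0 < wordB n σ ε (j + 1)))]
  simp only [wordB_succ_pos]
end

section
/- For every positive integer n and every real number x with x ≠ 1, (1−x)^{n+1} P_n((1+x)/(1−x)) = (1+x^2) · ∑_{σ ∈ S_n} (1+x)^{dda(σ)} · 2^{val(σ)} · (1+x^2)^{pk(σ)}, where the sum is over all permutations σ of {1,...,n} with the boundary convention σ(0) = σ(n+1) = n+1. -/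
open Finset

/-- The sum of a local statistic `g` over the `n` consecutive triples of a word. -/
def tripleSum (g : ℕ → ℕ → ℕ → ℕ) (w : ℕ → ℕ) (n : ℕ) : ℕ :=
  ∑ i ∈ range n, g (w i) (w (i + 1)) (w (i + 2))

/-- Indicator that the middle entry is a valley. -/
def valInd (a b c : ℕ) : ℕ := if b < a ∧ b < c then 1 else 0

/-- Indicator that the middle entry is a double ascent or a double descent. -/
def ddaInd (a b c : ℕ) : ℕ :=
  (if a < b ∧ b < c then 1 else 0) + (if b < a ∧ c < b then 1 else 0)

theorem card_filter_Icc_eq_sum_range (n : ℕ) (P : ℕ → Prop) [DecidablePred P] :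
    ((Icc 1 n).filter P).card = ∑ i ∈ range n, if P (i + 1) then 1 else 0 := by
  rw [card_filter]
  induction n with
  | zero => simp
  | succ n ih => rw [sum_Icc_succ_top (by omega), ih, sum_range_succ]

theorem valCount_eq_tripleSum (n : ℕ) (w : ℕ → ℕ) : valCount n w = tripleSum valInd w n := by
  unfold valCount tripleSum valInd
  rw [card_filter_Icc_eq_sum_range]
  rfl

theorem ddaCount_eq_tripleSum (n : ℕ) (w : ℕ → ℕ) : ddaCount n w = tripleSum ddaInd w n := by
  unfold ddaCount daCount ddCount tripleSum ddaInd
  rw [card_filter_Icc_eq_sum_range, card_filter_Icc_eq_sum_range, sum_add_distrib]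
  rfl

theorem valCount_add_eq_pkCount_add (n : ℕ) (w : ℕ → ℕ) (hw : ∀ i ≤ n, w i ≠ w (i + 1)) :
    valCount n w + (if w 0 < w 1 then 1 else 0) =
      pkCount n w + (if w n < w (n + 1) then 1 else 0) := by
  unfold valCount pkCount
  rw [card_filter_Icc_eq_sum_range, card_filter_Icc_eq_sum_range]
  induction n with
  | zero => simp
  | succ n ih =>
    have ih' := ih fun i hi => hw i (by omega)
    have h0 := hw n (by omega)
    have h1 := hw (n + 1) le_rfl
    rw [sum_range_succ, sum_range_succ]
    simp only [Nat.add_sub_cancel] at ih' ⊢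
    split_ifs at ih' ⊢ <;> omega

theorem ddaCount_add_valCount_add_pkCount (n : ℕ) (w : ℕ → ℕ)
    (hw : ∀ i ≤ n, w i ≠ w (i + 1)) :
    ddaCount n w + valCount n w + pkCount n w = n := by
  unfold ddaCount daCount ddCount valCount pkCount
  simp only [card_filter_Icc_eq_sum_range, ← sum_add_distrib]
  rw [sum_congr rfl (g := fun _ => 1)]
  · simp
  · intro i hi
    have h0 := hw i (by have := mem_range.1 hi; omega)
    have h1 := hw (i + 1) (by have := mem_range.1 hi; omega)
    simp only [Nat.add_sub_cancel]
    split_ifs <;> omega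

/-- Inserting a new minimum in the gap after position `p` only changes the triples
around that gap. -/
theorem tripleSum_insert (g : ℕ → ℕ → ℕ → ℕ)
    (hg : ∀ a b c, g (a + 1) (b + 1) (c + 1) = g a b c) (w w' : ℕ → ℕ) (p n : ℕ) (hp : p ≤ n)
    (hlow : ∀ i ≤ p, w' i = w i + 1) (hmid : w' (p + 1) = 0 + 1)
    (hhigh : ∀ i, p < i → w' (i + 1) = w i + 1) :
    tripleSum g w' (n + 1) + (if 1 ≤ p then g (w (p - 1)) (w p) (w (p + 1)) else 0)
        + (if p < n then g (w p) (w (p + 1)) (w (p + 2)) else 0) =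
      tripleSum g w n + (if 1 ≤ p then g (w (p - 1)) (w p) 0 else 0) + g (w p) 0 (w (p + 1))
        + (if p < n then g 0 (w (p + 1)) (w (p + 2)) else 0) := by
  have e1 : w' (p + 2) = w (p + 1) + 1 := hhigh (p + 1) (by omega)
  have e2 : w' (p + 3) = w (p + 2) + 1 := hhigh (p + 2) (by omega)
  have g1 : g (w' p) (w' (p + 1)) (w' (p + 2)) = g (w p) 0 (w (p + 1)) := by
    rw [hlow p le_rfl, hmid, e1, hg]
  have g2 : g (w' (p + 1)) (w' (p + 2)) (w' (p + 3)) = g 0 (w (p + 1)) (w (p + 2)) := by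
    rw [hmid, e1, e2, hg]
  unfold tripleSum
  induction n, hp using Nat.le_induction with
  | base =>
    rw [sum_range_succ, g1, if_neg (lt_irrefl p), if_neg (lt_irrefl p)]
    cases p with
    | zero => simp
    | succ q =>
      have hc : ∑ i ∈ range q, g (w' i) (w' (i + 1)) (w' (i + 2)) =
          ∑ i ∈ range q, g (w i) (w (i + 1)) (w (i + 2)) := by
        refine sum_congr rfl fun i hi => ?_
        have := mem_range.1 hi
        rw [hlow i (by omega), hlow (i + 1) (by omega), hlow (i + 2) (by omega), hg]
      have g0 : g (w' q) (w' (q + 1)) (w' (q + 2)) = g (w q) (w (q + 1)) 0 := by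
        rw [hlow q (by omega), hlow (q + 1) le_rfl, hmid, hg]
      rw [sum_range_succ, sum_range_succ, hc, g0]
      simp only [le_add_iff_nonneg_left, zero_le, if_true, Nat.add_sub_cancel, add_assoc,
        Nat.reduceAdd]
      omega
  | succ n hpn ih =>
    rw [sum_range_succ _ (n + 1), sum_range_succ (fun i => g (w i) (w (i + 1)) (w (i + 2))) n]
    rw [if_pos (show p < n + 1 by omega), if_pos (show p < n + 1 by omega)]
    rcases hpn.eq_or_lt with rfl | hlt
    · rw [if_neg (lt_irrefl p), if_neg (lt_irrefl p)] at ih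
      rw [g2]
      omega
    · rw [if_pos hlt, if_pos hlt] at ih
      have h3 : g (w' (n + 1)) (w' (n + 1 + 1)) (w' (n + 1 + 2)) =
          g (w n) (w (n + 1)) (w (n + 2)) := by
        rw [hhigh n hlt, hhigh (n + 1) (by omega), hhigh (n + 2) (by omega), hg]
      rw [h3]
      omega

/-- The permutation whose word is obtained from that of `σ` by inserting a new minimum
at position `p`. -/
def insertMin {n : ℕ} (p : Fin (n + 1)) (σ : Equiv.Perm (Fin n)) : Equiv.Perm (Fin (n + 1)) :=
  (finSuccEquiv' p).trans ((Equiv.optionCongr σ).trans (finSuccEquiv' 0).symm)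

theorem insertMin_self {n : ℕ} (p : Fin (n + 1)) (σ : Equiv.Perm (Fin n)) :
    insertMin p σ p = 0 := by
  simp [insertMin]

theorem insertMin_succAbove {n : ℕ} (p : Fin (n + 1)) (σ : Equiv.Perm (Fin n)) (i : Fin n) :
    insertMin p σ (p.succAbove i) = (σ i).succ := by
  simp [insertMin]

theorem insertMin_bijective (n : ℕ) :
    Function.Bijective fun q : Fin (n + 1) × Equiv.Perm (Fin n) => insertMin q.1 q.2 := by
  rw [Fintype.bijective_iff_injective_and_card]
  constructor
  · rintro ⟨p, σ⟩ ⟨q, τ⟩ h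
    replace h : insertMin p σ = insertMin q τ := h
    have hpq : p = q := by
      apply (insertMin q τ).injective
      rw [insertMin_self, ← h, insertMin_self]
    subst hpq
    have : σ = τ := by
      ext i
      have := congrArg (fun e => e (p.succAbove i)) h
      simp only [insertMin_succAbove, Fin.succ_inj] at this
      rw [this]
    rw [this]
  · simp [Fintype.card_perm, Nat.factorial_succ]

theorem extA_succ {n : ℕ} (σ : Equiv.Perm (Fin n)) (i : Fin n) :
    extA n σ (i + 1) = σ i + 1 := by
  have := i.2
  simp [extA, this]

theorem extA_insertMin_low {n : ℕ} (p : Fin (n + 1)) (σ : Equiv.Perm (Fin n)) (i : ℕ)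
    (hi : i ≤ p) : extA (n + 1) (insertMin p σ) i = extA n σ i + 1 := by
  cases i with
  | zero => simp [extA]
  | succ j =>
    have hp := p.2
    have hj : j < n := by omega
    have h := insertMin_succAbove p σ ⟨j, hj⟩
    rw [Fin.succAbove_of_castSucc_lt _ _ (by rw [Fin.lt_def]; simp; omega)] at h
    have e := extA_succ (insertMin p σ) (Fin.castSucc ⟨j, hj⟩)
    have e' := extA_succ σ ⟨j, hj⟩
    rw [h] at e
    simpa [e'] using e

theorem extA_insertMin_high {n : ℕ} (p : Fin (n + 1)) (σ : Equiv.Perm (Fin n)) (i : ℕ)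
    (hi : (p : ℕ) < i) : extA (n + 1) (insertMin p σ) (i + 1) = extA n σ i + 1 := by
  obtain ⟨j, rfl⟩ : ∃ j, i = j + 1 := ⟨i - 1, by omega⟩
  by_cases hj : j < n
  · have h := insertMin_succAbove p σ ⟨j, hj⟩
    rw [Fin.succAbove_of_le_castSucc _ _ (by rw [Fin.le_def]; simp; omega)] at h
    have e := extA_succ (insertMin p σ) (Fin.succ ⟨j, hj⟩)
    have e' := extA_succ σ ⟨j, hj⟩
    rw [h] at e
    simpa [e'] using e
  · have h1 : ¬ j + 1 ≤ n := by omega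
    simp [extA, h1]

theorem extA_pos {n : ℕ} (σ : Equiv.Perm (Fin n)) (i : ℕ) : 0 < extA n σ i := by
  unfold extA
  split_ifs <;> omega

theorem extA_succ_lt {n : ℕ} (σ : Equiv.Perm (Fin n)) (i : Fin n) : extA n σ (i + 1) < n + 1 := by
  rw [extA_succ]
  omega

theorem extA_ne_succ {n : ℕ} (hn : 0 < n) (σ : Equiv.Perm (Fin n)) (i : ℕ) (hi : i ≤ n) :
    extA n σ i ≠ extA n σ (i + 1) := by
  have h0 : extA n σ 0 = n + 1 := by simp [extA]
  have hl : extA n σ (n + 1) = n + 1 := by simp [extA]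
  rcases Nat.eq_zero_or_pos i with rfl | hpos
  · have := extA_succ_lt σ ⟨0, hn⟩
    simp only at this
    omega
  · obtain ⟨j, rfl⟩ : ∃ j, i = j + 1 := ⟨i - 1, by omega⟩
    have h1 := extA_succ σ ⟨j, hi⟩
    rcases Nat.lt_or_ge (j + 1) n with h | h
    · have h2 := extA_succ σ ⟨j + 1, h⟩
      intro he
      have : σ ⟨j, hi⟩ = σ ⟨j + 1, h⟩ := by
        apply Fin.ext
        simp only at h1 h2
        omega
      have := congrArg Fin.val (σ.injective this)
      simp at this
    · have : j + 1 = n := by omega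
      have h3 := extA_succ_lt σ ⟨j, hi⟩
      simp only at h3
      rw [this] at h3 ⊢
      omega

/-- The weight recursion under insertion of a new minimum in all gaps of a word with
maximal boundary entries. -/
theorem sum_insert_weight {R : Type*} [CommSemiring R] (y z : R) (n : ℕ) (w : ℕ → ℕ)
    (w' : ℕ → ℕ → ℕ) (hpos : ∀ i, 0 < w i) (hne : ∀ i ≤ n, w i ≠ w (i + 1))
    (hfirst : w 1 < w 0) (hlast : w n < w (n + 1))
    (hlow : ∀ p ≤ n, ∀ i ≤ p, w' p i = w i + 1) (hmid : ∀ p ≤ n, w' p (p + 1) = 0 + 1)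
    (hhigh : ∀ p ≤ n, ∀ i, p < i → w' p (i + 1) = w i + 1) :
    ∑ p ∈ range (n + 1), y ^ ddaCount (n + 1) (w' p) * z ^ valCount (n + 1) (w' p) =
      ddaCount n w * (y ^ (ddaCount n w - 1) * z ^ (valCount n w + 1)) +
        2 * valCount n w * (y ^ (ddaCount n w + 1) * z ^ valCount n w) := by
  set d := ddaCount n w with hd
  set v := valCount n w with hv
  set A : R := y ^ (d - 1) * z ^ (v + 1)
  set B : R := y ^ (d + 1) * z ^ v
  have key : ∀ p ∈ range (n + 1),
      y ^ ddaCount (n + 1) (w' p) * z ^ valCount (n + 1) (w' p) =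
        (if p < n ∧ w (p + 1) < w p ∧ w (p + 2) < w (p + 1) then A else 0) +
        (if p < n ∧ w (p + 1) < w p ∧ w (p + 1) < w (p + 2) then B else 0) +
        (if 1 ≤ p ∧ w (p - 1) < w p ∧ w p < w (p + 1) then A else 0) +
        (if 1 ≤ p ∧ w p < w (p - 1) ∧ w p < w (p + 1) then B else 0) := by
    intro p hp
    have hp' : p ≤ n := by have := mem_range.1 hp; omega
    have hD := tripleSum_insert ddaInd (by intros; simp [ddaInd]) w (w' p) p n hp'
      (hlow p hp') (hmid p hp') (hhigh p hp')
    have hV := tripleSum_insert valInd (by intros; simp [valInd]) w (w' p) p n hp'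
      (hlow p hp') (hmid p hp') (hhigh p hp')
    rw [← ddaCount_eq_tripleSum, ← ddaCount_eq_tripleSum, ← hd] at hD
    rw [← valCount_eq_tripleSum, ← valCount_eq_tripleSum, ← hv] at hV
    generalize ddaCount (n + 1) (w' p) = d' at *
    generalize valCount (n + 1) (w' p) = v' at *
    have p0 := hpos p
    have p1 := hpos (p + 1)
    simp only [ddaInd, valInd] at hD hV
    rcases lt_or_gt_of_ne (hne p hp') with hlt | hgt
    · have hp1 : 1 ≤ p := by
        by_contra hc
        obtain rfl : p = 0 := by omega
        exact absurd hlt hfirst.not_gt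
      have hm := hne (p - 1) (by omega)
      rw [Nat.sub_add_cancel hp1] at hm
      rcases lt_or_gt_of_ne hm with h | h
      · simp [hp1, hlt, hlt.not_gt, h, h.not_gt, p0, p1] at hD hV ⊢
        have e1 : d' = d - 1 := by omega
        have e2 : v' = v + 1 := by omega
        rw [e1, e2]
      · simp [hp1, hlt, hlt.not_gt, h, h.not_gt, p0, p1] at hD hV ⊢
        have e1 : d' = d + 1 := by omega
        have e2 : v' = v := by omega
        rw [e1, e2]
    · have hpn : p < n := by
        refine lt_of_le_of_ne hp' fun hc => ?_
        rw [hc] at hgt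
        exact absurd hlast hgt.not_gt
      rcases lt_or_gt_of_ne (hne (p + 1) hpn) with h | h
      · simp [hpn, hgt, hgt.not_gt, h, h.not_gt, p0, p1] at hD hV ⊢
        have e1 : d' = d + 1 := by split_ifs at hD hV <;> omega
        have e2 : v' = v := by split_ifs at hD hV <;> omega
        rw [e1, e2]
      · simp [hpn, hgt, hgt.not_gt, h, h.not_gt, p0, p1] at hD hV ⊢
        have e1 : d' = d - 1 := by split_ifs at hD hV <;> omega
        have e2 : v' = v + 1 := by split_ifs at hD hV <;> omega
        rw [e1, e2]
  have left (P : ℕ → Prop) [DecidablePred P] (C : R) :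
      ∑ p ∈ range (n + 1), (if p < n ∧ P (p + 1) then C else 0) =
        ((Icc 1 n).filter P).card * C := by
    rw [sum_range_succ, if_neg (by simp), add_zero, card_filter_Icc_eq_sum_range, Nat.cast_sum,
      sum_mul]
    refine sum_congr rfl fun p hp => ?_
    by_cases h : P (p + 1) <;> simp [mem_range.1 hp, h]
  have right (P : ℕ → Prop) [DecidablePred P] (C : R) :
      ∑ p ∈ range (n + 1), (if 1 ≤ p ∧ P p then C else 0) =
        ((Icc 1 n).filter P).card * C := by
    rw [sum_range_succ', if_neg (by simp), add_zero, card_filter_Icc_eq_sum_range, Nat.cast_sum,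
      sum_mul]
    refine sum_congr rfl fun p hp => ?_
    by_cases h : P (p + 1) <;> simp [h]
  rw [sum_congr rfl key]
  simp only [sum_add_distrib]
  have s1 := left (fun i => w i < w (i - 1) ∧ w (i + 1) < w i) A
  have s2 := left (fun i => w i < w (i - 1) ∧ w i < w (i + 1)) B
  have s3 := right (fun i => w (i - 1) < w i ∧ w i < w (i + 1)) A
  have s4 := right (fun i => w i < w (i - 1) ∧ w i < w (i + 1)) B
  simp only [Nat.add_sub_cancel] at s1 s2
  rw [s1, s2, s3, s4, hd, hv, ddaCount, daCount, ddCount, valCount]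
  push_cast
  ring

theorem tanP_eq_sum (n : ℕ) (hn : 0 < n) :
    tanP n = ∑ σ : Equiv.Perm (Fin n), (Polynomial.X : Polynomial ℝ) ^ ddaCount n (extA n σ) *
      (1 + Polynomial.X ^ 2) ^ valCount n (extA n σ) := by
  induction n, hn using Nat.le_induction with
  | base =>
    have h0 : ∀ σ : Equiv.Perm (Fin 1), valCount 1 (extA 1 σ) = 1 := by decide
    have h1 : ∀ σ : Equiv.Perm (Fin 1), ddaCount 1 (extA 1 σ) = 0 := by decide
    simp [h0, h1, tanP]
  | succ n hn ih =>
    rw [tanP, ih, ← (Equiv.ofBijective _ (insertMin_bijective n)).sum_comp, Fintype.sum_prod_type,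
      sum_comm, Polynomial.derivative_sum, mul_sum]
    refine sum_congr rfl fun σ _ => ?_
    set w := extA n σ with hw
    have h0 : w 0 = n + 1 := by simp [hw, extA]
    have hl : w (n + 1) = n + 1 := by simp [hw, extA]
    have hf : w 1 < n + 1 := extA_succ_lt σ ⟨0, hn⟩
    have hr : w n < n + 1 := by
      simpa [hw, Nat.sub_add_cancel (show 1 ≤ n from hn)] using extA_succ_lt σ ⟨n - 1, by omega⟩
    have key := sum_insert_weight (Polynomial.X : Polynomial ℝ) (1 + Polynomial.X ^ 2) n w
      (fun p => extA (n + 1) (insertMin (Fin.ofNat (n + 1) p) σ)) (extA_pos σ)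
      (extA_ne_succ hn σ) (by omega) (by omega)
      (fun p hp i hi => extA_insertMin_low _ σ i
        (by simpa [Nat.mod_eq_of_lt (Nat.lt_succ_of_le hp)] using hi))
      (fun p hp => by
        have := extA_succ (insertMin (Fin.ofNat (n + 1) p) σ) (Fin.ofNat (n + 1) p)
        rw [insertMin_self] at this
        simpa [Nat.mod_eq_of_lt (Nat.lt_succ_of_le hp)] using this)
      (fun p hp i hi => extA_insertMin_high _ σ i
        (by simpa [Nat.mod_eq_of_lt (Nat.lt_succ_of_le hp)] using hi))
    rw [← Fin.sum_univ_eq_sum_range (fun p =>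
      (Polynomial.X : Polynomial ℝ) ^
          ddaCount (n + 1) (extA (n + 1) (insertMin (Fin.ofNat (n + 1) p) σ)) *
        (1 + Polynomial.X ^ 2) ^
          valCount (n + 1) (extA (n + 1) (insertMin (Fin.ofNat (n + 1) p) σ)))] at key
    simp only [Fin.ofNat_eq_cast, Fin.cast_val_eq_self] at key
    simp only [Equiv.ofBijective_apply]
    rw [key, Polynomial.derivative_mul, Polynomial.derivative_X_pow, Polynomial.derivative_pow]
    generalize ddaCount n w = d
    rcases valCount n w with _ | v
    · simp
      ring
    · simp
      ring

/-- For every positive integer `n` and real `x ≠ 1`,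
`(1-x)^{n+1} P_n((1+x)/(1-x)) = (1+x²) · ∑_{σ ∈ S_n} (1+x)^{dda(σ)} 2^{val(σ)} (1+x²)^{pk(σ)}`,
with the boundary convention `σ(0) = σ(n+1) = n+1`. -/
theorem stmt8 (n : ℕ) (hn : 0 < n) (x : ℝ) (hx : x ≠ 1) :
    (1 - x) ^ (n + 1) * (tanP n).eval ((1 + x) / (1 - x)) =
      (1 + x ^ 2) *
        ∑ σ : Equiv.Perm (Fin n),
          (1 + x) ^ ddaCount n (extA n σ) * 2 ^ valCount n (extA n σ) *
            (1 + x ^ 2) ^ pkCount n (extA n σ) := by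
  have hx' : 1 - x ≠ 0 := sub_ne_zero.2 hx.symm
  rw [tanP_eq_sum n hn, Polynomial.eval_finsetSum, mul_sum, mul_sum]
  refine sum_congr rfl fun σ _ => ?_
  have h0 : extA n σ 0 = n + 1 := by simp [extA]
  have hl : extA n σ (n + 1) = n + 1 := by simp [extA]
  have hf : extA n σ 1 < n + 1 := extA_succ_lt σ ⟨0, hn⟩
  have hr : extA n σ n < n + 1 := by
    simpa [Nat.sub_add_cancel (show 1 ≤ n from hn)] using extA_succ_lt σ ⟨n - 1, by omega⟩
  have h1 := ddaCount_add_valCount_add_pkCount n _ (extA_ne_succ hn σ)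
  have h2 := valCount_add_eq_pkCount_add n _ (extA_ne_succ hn σ)
  rw [if_neg (by omega), if_pos (by omega)] at h2
  have hsq : 1 + ((1 + x) / (1 - x)) ^ 2 = 2 * (1 + x ^ 2) / (1 - x) ^ 2 := by
    field_simp
    ring
  have hn' : n + 1 = ddaCount n (extA n σ) + 2 * valCount n (extA n σ) := by omega
  have hv : valCount n (extA n σ) = pkCount n (extA n σ) + 1 := by omega
  simp only [Polynomial.eval_mul, Polynomial.eval_pow, Polynomial.eval_add, Polynomial.eval_one,
    Polynomial.eval_X]
  rw [hsq, hn', hv]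
  generalize ddaCount n (extA n σ) = d
  generalize pkCount n (extA n σ) = k
  rw [div_pow, div_pow, mul_pow, ← pow_mul, pow_add]
  field_simp
  ring
end
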